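/- Let T ⊆ M, let Q be a set of monoid projections on M, let I be a radical order ideal of M, and let ℵ be an infinite regular cardinal with ℵ ≥ κ(Q[T], I). Suppose M decomposes as M = I ∪ ⋃_{α ∈ A} M_α where card A < ℵ and each M_α is disjoint from I. Then Q decomposes as Q = Q₀ ∪ ⋃_{i ∈ J} Q_i where card J < ℵ, Q₀ = {Q ∈ Q : Q(f) ∈ I for all f ∈ T}, and for each i ∈ J there exist α_i ∈ A and f_i ∈ T such that Q(f_i) ∈ M_{α_i} for every Q ∈ Q_i. -/

import Mathlib

open Cardinal

universe u

/-- A positively ordered (p.o.) monoid. -/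
class POMonoid (M : Type*) extends CommMonoid M, PartialOrder M, OrderBot M where
  le_one : ∀ f : M, f ≤ 1
  mul_le_mul_of_le : ∀ {f g : M}, f ≤ g → ∀ h : M, f * h ≤ g * h

/-- An order ideal: downward closed set. -/
def IsOrderIdeal {M : Type*} [POMonoid M] (I : Set M) : Prop :=
  ∀ f ∈ I, ∀ g : M, g ≤ f → g ∈ I

/-- A radical set: `f ∈ I` whenever `f ^ n ∈ I` for some `n ≥ 1`. -/
def IsRadicalSet {M : Type*} [POMonoid M] (I : Set M) : Prop :=
  ∀ f : M, ∀ n : ℕ, 1 ≤ n → f ^ n ∈ I → f ∈ I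

/-- `D` is mutually `I`-disjoint. -/
def MutuallyDisjointMod {M : Type*} [POMonoid M] (I D : Set M) : Prop :=
  D ∩ I = ∅ ∧ ∀ f ∈ D, ∀ g ∈ D, f ≠ g → f * g ∈ I

/-- `κ(T, I)`. -/
noncomputable def kappa {M : Type*} [POMonoid M] (T I : Set M) : Cardinal :=
  sInf {c : Cardinal | ∀ D : Set M, D ⊆ T → MutuallyDisjointMod I D → #D < c}

/-- A monoid projection. -/
def IsMonoidProjection {M : Type*} [POMonoid M] (Q : M → M) : Prop :=
  Monotone Q ∧ (∀ f : M, Q f ≤ f) ∧ ∀ f g : M, f * Q g ≤ Q (f * g)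

/-- `𝒬[T]`. -/
def projImage {M : Type*} [POMonoid M] (𝒬 : Set (M → M)) (T : Set M) : Set M :=
  {h : M | ∃ Q ∈ 𝒬, ∃ f ∈ T, Q f = h}

/-- A mutually `I`-disjoint subset of `T` has cardinality less than `κ(T, I)`. -/
theorem MutuallyDisjointMod.mk_lt_kappa {M : Type*} [POMonoid M] {I T D : Set M}
    (hD : MutuallyDisjointMod I D) (hDT : D ⊆ T) : #D < kappa T I := by
  have hne : {c : Cardinal | ∀ D : Set M, D ⊆ T → MutuallyDisjointMod I D → #D < c}.Nonempty :=
    ⟨Order.succ #M, fun D _ _ => Order.lt_succ_of_le (mk_set_le D)⟩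
  exact csInf_mem hne D hDT hD

/-- Every set contains a maximal mutually `I`-disjoint subset. -/
theorem exists_maximal_mutuallyDisjointMod {M : Type*} [POMonoid M] (I T : Set M) :
    ∃ D, Maximal (fun D => D ⊆ T ∧ MutuallyDisjointMod I D) D := by
  refine zorn_subset {D | D ⊆ T ∧ MutuallyDisjointMod I D} fun c hc hchain => ?_
  refine ⟨⋃₀ c, ⟨Set.sUnion_subset fun D hD => (hc hD).1, ?_, ?_⟩,
    fun D hD => Set.subset_sUnion_of_mem hD⟩
  · refine Set.eq_empty_of_forall_notMem ?_
    rintro x ⟨⟨D, hD, hx⟩, hxI⟩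
    exact (hc hD).2.1.le ⟨hx, hxI⟩
  · rintro f ⟨D, hD, hf⟩ g ⟨E, hE, hg⟩ hfg
    rcases hchain.total hD hE with h | h
    · exact (hc hE).2.2 f (h hf) g hg hfg
    · exact (hc hD).2.2 f hf g (h hg) hfg

/-- An element of `T` outside a radical set `I` meets, modulo `I`, some member of any maximal
mutually `I`-disjoint subset of `T`. -/
theorem exists_mul_notMem_of_maximal {M : Type*} [POMonoid M] {I T D : Set M}
    (hrad : IsRadicalSet I) (hD : Maximal (fun D => D ⊆ T ∧ MutuallyDisjointMod I D) D)
    {h : M} (hT : h ∈ T) (hI : h ∉ I) : ∃ d ∈ D, h * d ∉ I := by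
  by_contra! hmul
  have hins : MutuallyDisjointMod I (insert h D) := by
    refine ⟨Set.eq_empty_of_forall_notMem ?_, ?_⟩
    · rintro x ⟨rfl | hx, hxI⟩
      · exact hI hxI
      · exact hD.prop.2.1.le ⟨hx, hxI⟩
    · rintro f (rfl | hf) g (rfl | hg) hfg
      · exact absurd rfl hfg
      · exact hmul g hg
      · exact mul_comm g f ▸ hmul f hf
      · exact hD.prop.2.2 f hf g hg hfg
  have hmem : h ∈ D := hD.le_of_ge ⟨Set.insert_subset hT hD.prop.1, hins⟩
    (Set.subset_insert h D) (Set.mem_insert h D)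
  exact hI (hrad h 2 one_le_two (pow_two h ▸ hmul h hmem))

/-- Monoid projections satisfy `Q f * P g ≤ Q g`. -/
theorem IsMonoidProjection.mul_le {M : Type*} [POMonoid M] {P Q : M → M}
    (hQ : IsMonoidProjection Q) (hP : IsMonoidProjection P) (f g : M) : Q f * P g ≤ Q g := by
  have hmul (a : M) {b c : M} (h : b ≤ c) : a * b ≤ a * c := by
    simpa only [mul_comm a] using POMonoid.mul_le_mul_of_le h a
  calc Q f * P g ≤ Q f * g := hmul _ (hP.2.1 g)
    _ = g * Q f := mul_comm _ _
    _ ≤ Q (g * f) := hQ.2.2 g f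
    _ ≤ Q g := hQ.1 (by simpa using hmul g (POMonoid.le_one f))

/-- Partition theorem: a decomposition of `M` as `I ∪ ⋃_α M_α` over fewer than
`ℵ` indices (`ℵ` regular, `ℵ ≥ κ(𝒬[T], I)`) induces a decomposition of `𝒬`
as `𝒬₀ ∪ ⋃_{i ∈ J} 𝒬_i`, with `card J < ℵ`, where `𝒬₀` consists of the
projections mapping `T` into `I`, and each `𝒬_i` sends some `f_i ∈ T` into
some `M_{α_i}`. -/
theorem stmt13 {M : Type u} [POMonoid M] (T : Set M) (𝒬 : Set (M → M))
    (h𝒬 : ∀ Q ∈ 𝒬, IsMonoidProjection Q) (I : Set M)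
    (hord : IsOrderIdeal I) (hrad : IsRadicalSet I)
    (ℵ : Cardinal.{u}) (hreg : ℵ.IsRegular)
    (hge : kappa (projImage 𝒬 T) I ≤ ℵ)
    {A : Type u} (Mfam : A → Set M) (hcard : #A < ℵ)
    (hdisj : ∀ α : A, Mfam α ∩ I = ∅)
    (hdecomp : Set.univ = I ∪ ⋃ α : A, Mfam α) :
    ∃ (J : Set (A × M)) (𝒬i : A × M → Set (M → M)),
      #J < ℵ ∧ (∀ p ∈ J, p.2 ∈ T) ∧
      (𝒬 = {Q : M → M | Q ∈ 𝒬 ∧ ∀ f ∈ T, Q f ∈ I} ∪ ⋃ p ∈ J, 𝒬i p) ∧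
      (∀ p ∈ J, ∀ Q ∈ 𝒬i p, Q p.2 ∈ Mfam p.1) := by
  obtain ⟨D, hD⟩ := exists_maximal_mutuallyDisjointMod I (projImage 𝒬 T)
  have hDcard : #D < ℵ := (hD.prop.2.mk_lt_kappa hD.prop.1).trans_le hge
  choose P hP g hgT hPg using fun d : D => hD.prop.1 d.2
  refine ⟨Set.univ ×ˢ Set.range g, fun p => {Q | Q ∈ 𝒬 ∧ Q p.2 ∈ Mfam p.1}, ?_, ?_, ?_, ?_⟩
  · rw [mk_setProd, mk_univ]
    exact mul_lt_of_lt hreg.aleph0_le hcard (mk_range_le.trans_lt hDcard)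
  · rintro ⟨α, _⟩ ⟨-, d, rfl⟩
    exact hgT d
  · refine Set.Subset.antisymm (fun Q hQ => ?_) ?_
    · by_cases hQT : ∀ f ∈ T, Q f ∈ I
      · exact Or.inl ⟨hQ, hQT⟩
      push Not at hQT
      obtain ⟨f, hf, hQf⟩ := hQT
      obtain ⟨d, hd, hmul⟩ := exists_mul_notMem_of_maximal hrad hD ⟨Q, hQ, f, hf, rfl⟩ hQf
      have hQg : Q (g ⟨d, hd⟩) ∉ I := fun hmem => hmul <| hord _ hmem _ <| by
        simpa only [hPg] using (h𝒬 Q hQ).mul_le (h𝒬 _ (hP ⟨d, hd⟩)) f (g ⟨d, hd⟩)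
      obtain ⟨α, hα⟩ := Set.mem_iUnion.1
        ((hdecomp.le (Set.mem_univ (Q (g ⟨d, hd⟩)))).resolve_left hQg)
      exact Or.inr (Set.mem_biUnion (x := (α, g ⟨d, hd⟩))
        ⟨Set.mem_univ _, Set.mem_range_self _⟩ ⟨hQ, hα⟩)
    · rintro Q (hQ | hQ)
      · exact hQ.1
      · obtain ⟨p, -, hQp⟩ := Set.mem_iUnion₂.1 hQ
        exact hQp.1
  · exact fun p _ Q hQ => hQ.2
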